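/- For every smooth matrix field S : ℝ³ → ℝ^{3×3} one has 2 skw(Rot S) = spn(Div(S^⊤) − grad tr S); in particular, if tr S = 0 pointwise, then 2 skw(Rot S) = spn(Div S^⊤). Consequently rot Div(S^⊤) = 2 rot(spn⁻¹ skw Rot S). -/

import Mathlib

open Matrix

noncomputable section

/-- Points of `ℝ³`. -/
abbrev V3 := Fin 3 → ℝ
/-- Real `3×3` matrices. -/
abbrev M3 := Matrix (Fin 3) (Fin 3) ℝ

/-- Partial derivative `∂ᵢ f` of a scalar function on `ℝ³`. -/
def pd (i : Fin 3) (f : V3 → ℝ) (x : V3) : ℝ := fderiv ℝ f x (Pi.single i 1)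

/-- Gradient of a scalar function. -/
def grad (f : V3 → ℝ) (x : V3) : V3 := fun i => pd i f x

/-- Divergence of a vector field. -/
def vdiv (v : V3 → V3) (x : V3) : ℝ := ∑ i, pd i (fun y => v y i) x

/-- Curl (rotation) of a vector field. -/
def vrot (v : V3 → V3) (x : V3) : V3 :=
  ![pd 1 (fun y => v y 2) x - pd 2 (fun y => v y 1) x,
    pd 2 (fun y => v y 0) x - pd 0 (fun y => v y 2) x,
    pd 0 (fun y => v y 1) x - pd 1 (fun y => v y 0) x]

/-- Jacobian matrix `(Grad v)_{ij} = ∂_j v_i` of a vector field. -/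
def vGrad (v : V3 → V3) (x : V3) : M3 := Matrix.of fun i j => pd j (fun y => v y i) x

/-- Row-wise curl of a matrix field. -/
def mRot (S : V3 → M3) (x : V3) : M3 := Matrix.of fun i => vrot (fun y => S y i) x

/-- Row-wise divergence of a matrix field. -/
def mDiv (S : V3 → M3) (x : V3) : V3 := fun i => vdiv (fun y => S y i) x

/-- The second order operator `RotRot^⊤ S = Rot ((Rot S)ᵀ)`. -/
def rotRotT (S : V3 → M3) (x : V3) : M3 := mRot (fun y => (mRot S y)ᵀ) x

/-- Symmetric part of a matrix. -/
def msym (M : M3) : M3 := (2⁻¹ : ℝ) • (M + Mᵀ)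

/-- Skew-symmetric part of a matrix. -/
def mskw (M : M3) : M3 := (2⁻¹ : ℝ) • (M - Mᵀ)

/-- Deviatoric (trace-free) part of a matrix. -/
def mdev (M : M3) : M3 := M - (Matrix.trace M / 3) • (1 : M3)

/-- The skew-symmetric matrix `spn w` with `(spn w) x = w × x`. -/
def spn (w : V3) : M3 := !![0, -w 2, w 1; w 2, 0, -w 0; -w 1, w 0, 0]

/-- The axial vector of a (skew-symmetric) matrix; inverse of `spn`. -/
def spnInv (M : M3) : V3 := ![M 2 1, M 0 2, M 1 0]

end

theorem ContDiff.pd {f : V3 → ℝ} (hf : ContDiff ℝ (⊤ : ℕ∞) f) (i : Fin 3) :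
    ContDiff ℝ (⊤ : ℕ∞) (pd i f) :=
  (hf.fderiv_right (m := (⊤ : ℕ∞)) le_rfl).clm_apply contDiff_const

theorem pd_sub {f g : V3 → ℝ} {x : V3} (hf : DifferentiableAt ℝ f x)
    (hg : DifferentiableAt ℝ g x) (i : Fin 3) :
    pd i (fun y => f y - g y) x = pd i f x - pd i g x := by
  simp only [pd]
  rw [fderiv_fun_sub hf hg, _root_.sub_apply]

theorem pd_const_mul (c : ℝ) {f : V3 → ℝ} {x : V3} (hf : DifferentiableAt ℝ f x) (i : Fin 3) :
    pd i (fun y => c * f y) x = c * pd i f x := by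
  simp only [pd]
  rw [fderiv_const_mul hf, _root_.smul_apply, smul_eq_mul]

theorem pd_sum {ι : Type*} {s : Finset ι} {f : ι → V3 → ℝ} {x : V3}
    (hf : ∀ j ∈ s, DifferentiableAt ℝ (f j) x) (i : Fin 3) :
    pd i (fun y => ∑ j ∈ s, f j y) x = ∑ j ∈ s, pd i (f j) x := by
  simp only [pd]
  rw [fderiv_fun_sum hf, _root_.sum_apply]

/-- Partial derivatives of a smooth function commute. -/
theorem pd_comm {f : V3 → ℝ} (hf : ContDiff ℝ (⊤ : ℕ∞) f) (i j : Fin 3) (x : V3) :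
    pd i (pd j f) x = pd j (pd i f) x := by
  have hd : DifferentiableAt ℝ (fderiv ℝ f) x :=
    (hf.fderiv_right (m := (⊤ : ℕ∞)) le_rfl).differentiable (by simp) x
  have h (k l : Fin 3) :
      pd k (pd l f) x = fderiv ℝ (fderiv ℝ f) x (Pi.single k 1) (Pi.single l 1) := by
    change fderiv ℝ (fun y => fderiv ℝ f y (Pi.single l 1)) x (Pi.single k 1) = _
    rw [fderiv_clm_apply hd (differentiableAt_const _)]
    simp
  rw [h, h]
  exact hf.contDiffAt.isSymmSndFDerivAt
    (by rw [minSmoothness_of_isRCLikeNormedField]; exact WithTop.coe_le_coe.2 (le_top (a := 2))) _ _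

theorem vrot_sub {u v : V3 → V3} {x : V3} (hu : ∀ i, DifferentiableAt ℝ (fun y => u y i) x)
    (hv : ∀ i, DifferentiableAt ℝ (fun y => v y i) x) :
    vrot (fun y => u y - v y) x = vrot u x - vrot v x := by
  ext k
  fin_cases k <;> simp [vrot, pd_sub, hu, hv] <;> ring

theorem vrot_const_smul (c : ℝ) {v : V3 → V3} {x : V3}
    (hv : ∀ i, DifferentiableAt ℝ (fun y => v y i) x) :
    vrot (fun y => c • v y) x = c • vrot v x := by
  ext k
  fin_cases k <;> simp [vrot, pd_const_mul, hv] <;> ring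

/-- The curl of a gradient vanishes. -/
theorem vrot_grad {f : V3 → ℝ} (hf : ContDiff ℝ (⊤ : ℕ∞) f) (x : V3) :
    vrot (grad f) x = 0 := by
  have h (i j : Fin 3) : pd i (fun y => pd j f y) x = pd j (fun y => pd i f y) x :=
    pd_comm hf i j x
  ext k
  fin_cases k
  · simp [vrot, grad, h 1 2]
  · simp [vrot, grad, h 2 0]
  · simp [vrot, grad, h 0 1]

theorem spnInv_spn (w : V3) : spnInv (spn w) = w := by
  ext k
  fin_cases k <;> simp [spnInv, spn]

theorem spnInv_smul (c : ℝ) (M : M3) : spnInv (c • M) = c • spnInv M := by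
  ext k
  fin_cases k <;> simp [spnInv]

theorem grad_trace {S : V3 → M3} {x : V3}
    (hS : ∀ i j, DifferentiableAt ℝ (fun y => S y i j) x) :
    grad (fun y => Matrix.trace (S y)) x = fun i => ∑ j, pd i (fun y => S y j j) x := by
  ext i
  exact pd_sum (fun j _ => hS j j) i

theorem two_smul_mskw_mRot_eq_spn {S : V3 → M3} {x : V3}
    (hS : ∀ i j, DifferentiableAt ℝ (fun y => S y i j) x) :
    (2 : ℝ) • mskw (mRot S x) =
      spn (mDiv (fun y => (S y)ᵀ) x - grad (fun y => Matrix.trace (S y)) x) := by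
  rw [grad_trace hS]
  ext i j
  fin_cases i <;> fin_cases j <;>
    simp [mskw, mRot, vrot, spn, mDiv, vdiv, Fin.sum_univ_three] <;> ring

/-- `2 skw (Rot S) = spn (Div Sᵀ - grad tr S)`; if `tr S = 0` then
`2 skw (Rot S) = spn (Div Sᵀ)`; and `rot Div Sᵀ = 2 rot (spn⁻¹ skw Rot S)`. -/
theorem two_mskw_mRot (S : V3 → M3)
    (hS : ∀ i j, ContDiff ℝ (⊤ : ℕ∞) fun y => S y i j) :
    (∀ x, (2 : ℝ) • mskw (mRot S x) =
        spn (mDiv (fun y => (S y)ᵀ) x - grad (fun y => Matrix.trace (S y)) x)) ∧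
    ((∀ x, Matrix.trace (S x) = 0) →
      ∀ x, (2 : ℝ) • mskw (mRot S x) = spn (mDiv (fun y => (S y)ᵀ) x)) ∧
    (∀ x, vrot (fun y => mDiv (fun z => (S z)ᵀ) y) x =
        (2 : ℝ) • vrot (fun y => spnInv (mskw (mRot S y))) x) := by
  have hd (x : V3) (i j : Fin 3) : DifferentiableAt ℝ (fun y => S y i j) x :=
    (hS i j).differentiable (by simp) x
  have htr : ContDiff ℝ (⊤ : ℕ∞) fun y => Matrix.trace (S y) :=
    ContDiff.sum fun i _ => hS i i
  have hgrad (i : Fin 3) :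
      ContDiff ℝ (⊤ : ℕ∞) fun y => grad (fun z => Matrix.trace (S z)) y i := htr.pd i
  have hdiv (i : Fin 3) : ContDiff ℝ (⊤ : ℕ∞) fun y => mDiv (fun z => (S z)ᵀ) y i := by
    simp only [mDiv, vdiv, transpose_apply]
    exact ContDiff.sum fun j _ => (hS j i).pd j
  refine ⟨fun x => two_smul_mskw_mRot_eq_spn (hd x), fun h x => ?_, fun x => ?_⟩
  · have hg : grad (fun y => Matrix.trace (S y)) x = 0 := by
      ext i
      simp [grad, pd, h]
    rw [two_smul_mskw_mRot_eq_spn (hd x), hg, sub_zero]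
  · have haxial : (fun y => spnInv (mskw (mRot S y))) = fun y => (2⁻¹ : ℝ) •
        (mDiv (fun z => (S z)ᵀ) y - grad (fun z => Matrix.trace (S z)) y) := by
      funext y
      rw [← spnInv_spn (_ - _), ← two_smul_mskw_mRot_eq_spn (hd y), spnInv_smul,
        inv_smul_smul₀ two_ne_zero]
    have hgrad' (i : Fin 3) := (hgrad i).differentiable (by simp) x
    have hdiv' (i : Fin 3) := (hdiv i).differentiable (by simp) x
    have hsub (i : Fin 3) : DifferentiableAt ℝ (fun y => (mDiv (fun z => (S z)ᵀ) y -
        grad (fun z => Matrix.trace (S z)) y) i) x := (hdiv' i).sub (hgrad' i)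
    rw [haxial, vrot_const_smul _ hsub,
      smul_inv_smul₀ two_ne_zero, vrot_sub hdiv' hgrad', vrot_grad htr, sub_zero]
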